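/- arXiv:1906.05392 — 6 statements merged into one kernel-verified Lean document; each statement's English description precedes it below -/
import Mathlib

section
/- The Jacobian of the noiseless Gaussian mixture model is low-rank (Theorem A.1 of the paper). Consider a data set {(x_i, y_i)}_{i=1}^n ⊂ ℝ^d × ℝ^K generated by the Gaussian mixture model with K classes, C clusters per class, unit-norm cluster centers μ_{ℓ,ℓ̃}, and noise level σ = 0 (so each input equals its cluster center and the label is the one-hot vector of its class, cluster memberships being i.i.d. uniform over the KC clusters). Let Σ(X) be the multiclass neural tangent kernel of the input matrix X with output-layer standard deviation ν = 1/√k, and let I be the range of Σ(X). Let M = [μ_{1,1}; …; μ_{K,C}] ∈ ℝ^{KC×d} be the matrix of cluster centers and Σ̃(M) = (MMᵀ) ⊙ E_{g∼N(0,I_d)}[φ'(Mg)φ'(Mg)ᵀ] ∈ ℝ^{KC×KC}, and assume Σ̃(M) is full rank. Then with probability at least 1 − KC·exp(−n/(8KC)): (i) I is a K²C-dimensional subspace; (ii) the concatenated label vector y = (y_1ᵀ, …, y_nᵀ)ᵀ lies in I; (iii) the nonzero (top K²C) eigenvalues of Σ(X) lie between (n/(2KC))·s_min(Σ̃(M))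 and (2n/(KC))·‖Σ̃(M)‖, where s_min denotes the minimum singular value and ‖·‖ the spectral norm. -/
open Matrix MeasureTheory ProbabilityTheory
open scoped BigOperators ENNReal

/-- Spectral norm (largest singular value) of a real matrix. -/
noncomputable def specNorm {m n : Type*} [Fintype m] [Fintype n] [DecidableEq n]
    (A : Matrix m n ℝ) : ℝ :=
  ‖(Matrix.toEuclideanLin A).toContinuousLinearMap‖

/-- Euclidean norm of a finitely supported real vector given as a plain function. -/
noncomputable def euclNorm {n : Type*} [Fintype n] (v : n → ℝ) : ℝ :=
  Real.sqrt (∑ j, v j ^ 2)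

/-- Frobenius norm of a real matrix. -/
noncomputable def frobNorm {m n : Type*} [Fintype m] [Fintype n] (A : Matrix m n ℝ) : ℝ :=
  Real.sqrt (∑ i, ∑ j, A i j ^ 2)

/-- The standard Gaussian measure on `ℝ^d`. -/
noncomputable def stdGaussianPi (d : ℕ) : Measure (Fin d → ℝ) :=
  Measure.pi fun _ => gaussianReal 0 1

/-- The law of a symmetric Rademacher variable scaled by `c` (values `±c` with equal
probability). -/
noncomputable def radMeasure (c : ℝ) : Measure ℝ :=
  (2⁻¹ : ℝ≥0∞) • Measure.dirac c + (2⁻¹ : ℝ≥0∞) • Measure.dirac (-c)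

/-- Single-output neural tangent kernel entry: the inner product of the two data points
times the Gaussian expectation of the product of activation derivatives. -/
noncomputable def ntkEntry {d : ℕ} (φ : ℝ → ℝ) (x y : Fin d → ℝ) : ℝ :=
  (∑ m, x m * y m) *
    ∫ w, deriv φ (∑ m, x m * w m) * deriv φ (∑ m, y m * w m) ∂(stdGaussianPi d)

/-- The multiclass neural tangent kernel of a data matrix `X`
(Kronecker product of `I_K` with the Hadamard product of the expected derivative Gram
matrix and `X Xᵀ`). -/
noncomputable def mNTK {d n : ℕ} (K : ℕ) (φ : ℝ → ℝ) (X : Matrix (Fin n) (Fin d) ℝ) :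
    Matrix (Fin K × Fin n) (Fin K × Fin n) ℝ :=
  Matrix.of fun a b =>
    if a.1 = b.1 then ntkEntry φ (fun m => X a.2 m) (fun m => X b.2 m) else 0
/-- Minimum singular value of a square real matrix. -/
noncomputable def minSing {ι : Type*} [Fintype ι] [DecidableEq ι]
    (A : Matrix ι ι ℝ) : ℝ :=
  ⨅ v : {v : EuclideanSpace ℝ ι // ‖v‖ = 1}, ‖Matrix.toEuclideanLin A v.1‖

/-- The number of indices that `f` sends to `p`. -/
def fiberCount {ι κ : Type*} [Fintype κ] [DecidableEq ι] (f : κ → ι) (p : ι) : ℕ :=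
  (Finset.univ.filter fun i => f i = p).card

theorem fiberCount_le_of_card_le_two {ι : Type*} [Fintype ι] [DecidableEq ι] (n : ℕ)
    (hN : Fintype.card ι ≤ 2) (f : Fin n → ι) (p : ι) :
    (fiberCount f p : ℝ) ≤ 2 * (n / Fintype.card ι) := by
  have : Nonempty ι := ⟨p⟩
  have h0 : (0 : ℝ) < Fintype.card ι := by exact_mod_cast Fintype.card_pos
  have h2 : (Fintype.card ι : ℝ) ≤ 2 := by exact_mod_cast hN
  have h1 : (fiberCount f p : ℝ) ≤ n := by
    exact_mod_cast (Finset.card_filter_le _ _).trans (by simp)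
  refine h1.trans ?_
  rw [← mul_div_assoc, le_div_iff₀ h0]
  nlinarith [(Nat.cast_nonneg n : (0 : ℝ) ≤ n)]

section Concentration

variable {ι : Type*} [Fintype ι] [Nonempty ι] [DecidableEq ι] [MeasurableSpace ι]
  [MeasurableSingletonClass ι]

theorem integral_uniform_exp_indicator (p : ι) (s : ℝ) :
    ∫ x, Real.exp (s * if x = p then 1 else 0) ∂(PMF.uniformOfFintype ι).toMeasure
      = 1 + (Real.exp s - 1) / Fintype.card ι := by
  have hN : (Fintype.card ι : ℝ) ≠ 0 := by exact_mod_cast Fintype.card_ne_zero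
  have h : ∀ x : ι, Real.exp (s * if x = p then 1 else 0)
      = 1 + if x = p then Real.exp s - 1 else 0 := by
    intro x
    split_ifs <;> simp
  rw [PMF.integral_eq_sum]
  simp only [h, PMF.uniformOfFintype_apply, smul_eq_mul, ← Finset.mul_sum,
    Finset.sum_add_distrib, Finset.sum_ite_eq', Finset.mem_univ, if_true]
  simp
  field_simp

theorem mgf_fiberCount_le (n : ℕ) (p : ι) (s : ℝ) :
    mgf (fun f : Fin n → ι => (fiberCount f p : ℝ))
        (Measure.pi fun _ => (PMF.uniformOfFintype ι).toMeasure) s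
      ≤ Real.exp (n / Fintype.card ι * (Real.exp s - 1)) := by
  have h : ∀ f : Fin n → ι, Real.exp (s * (fiberCount f p : ℝ))
      = ∏ i, Real.exp (s * if f i = p then 1 else 0) := by
    intro f
    rw [← Real.exp_sum, ← Finset.mul_sum, Finset.sum_boole, fiberCount]
  have hnonneg : 0 ≤ 1 + (Real.exp s - 1) / Fintype.card ι := by
    rw [← integral_uniform_exp_indicator p s]
    exact integral_nonneg fun _ => (Real.exp_pos _).le
  simp only [mgf, h]
  rw [integral_fintype_prod_eq_prod (𝕜 := ℝ)
    (fun (_ : Fin n) (x : ι) => Real.exp (s * if x = p then 1 else 0))]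
  simp only [integral_uniform_exp_indicator, Finset.prod_const, Finset.card_univ,
    Fintype.card_fin]
  calc (1 + (Real.exp s - 1) / Fintype.card ι) ^ n
      ≤ Real.exp ((Real.exp s - 1) / Fintype.card ι) ^ n :=
        pow_le_pow_left₀ hnonneg ((add_comm _ _).trans_le (Real.add_one_le_exp _)) n
    _ = Real.exp (n / Fintype.card ι * (Real.exp s - 1)) := by
        rw [← Real.exp_nat_mul]
        congr 1
        ring

theorem measureReal_fiberCount_le_half (n : ℕ) (p : ι) :
    (Measure.pi fun _ : Fin n => (PMF.uniformOfFintype ι).toMeasure).real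
        {f | (fiberCount f p : ℝ) ≤ n / Fintype.card ι / 2}
      ≤ Real.exp (-(6 / 40 * (n / Fintype.card ι))) := by
  have hm : (0 : ℝ) ≤ n / Fintype.card ι := by positivity
  have hl := Real.log_two_lt_d9
  refine (measure_le_le_exp_mul_mgf (X := fun f : Fin n → ι => (fiberCount f p : ℝ))
    (t := -Real.log 2) _ (by linarith [Real.log_two_gt_d9]) .of_finite).trans ?_
  refine (mul_le_mul_of_nonneg_left (mgf_fiberCount_le n p _) (Real.exp_pos _).le).trans ?_
  rw [← Real.exp_add, Real.exp_neg, Real.exp_log two_pos]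
  refine Real.exp_le_exp.mpr ?_
  nlinarith

theorem measureReal_two_mul_le_fiberCount (n : ℕ) (p : ι) :
    (Measure.pi fun _ : Fin n => (PMF.uniformOfFintype ι).toMeasure).real
        {f | 2 * (n / Fintype.card ι : ℝ) ≤ fiberCount f p}
      ≤ Real.exp (-(15 / 40 * (n / Fintype.card ι))) := by
  have hm : (0 : ℝ) ≤ n / Fintype.card ι := by positivity
  have hl := Real.log_two_gt_d9
  refine (measure_ge_le_exp_mul_mgf (X := fun f : Fin n → ι => (fiberCount f p : ℝ))
    (t := Real.log 2) _ (by linarith) .of_finite).trans ?_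
  refine (mul_le_mul_of_nonneg_left (mgf_fiberCount_le n p _) (Real.exp_pos _).le).trans ?_
  rw [← Real.exp_add, Real.exp_log two_pos]
  refine Real.exp_le_exp.mpr ?_
  nlinarith

/-- The two Chernoff tails add up to at most `exp (-m / 8)` once `exp (-m / 8) ≤ 1 / 3`. -/
theorem exp_tails_le {m : ℝ} (hm : Real.exp (-(m / 8)) ≤ 1 / 3) :
    Real.exp (-(6 / 40 * m)) + Real.exp (-(15 / 40 * m)) ≤ Real.exp (-(m / 8)) := by
  obtain ⟨z, hz⟩ : ∃ z, z = Real.exp (-(m / 40)) := ⟨_, rfl⟩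
  have hz0 : 0 < z := hz ▸ Real.exp_pos _
  have e5 : Real.exp (-(m / 8)) = z ^ 5 := by
    rw [hz, ← Real.exp_nat_mul]; congr 1; push_cast; ring
  have e6 : Real.exp (-(6 / 40 * m)) = z ^ 6 := by
    rw [hz, ← Real.exp_nat_mul]; congr 1; push_cast; ring
  have e15 : Real.exp (-(15 / 40 * m)) = z ^ 15 := by
    rw [hz, ← Real.exp_nat_mul]; congr 1; push_cast; ring
  rw [e5] at hm ⊢
  rw [e6, e15]
  have hz85 : z < 85 / 100 := by
    by_contra! h
    have := pow_le_pow_left₀ (by norm_num) h 5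
    norm_num at this
    linarith
  have h10 : z ^ 10 ≤ 1 / 9 := by
    have := pow_le_pow_left₀ (by positivity) hm 2
    calc z ^ 10 = (z ^ 5) ^ 2 := by ring
      _ ≤ 1 / 9 := by linarith
  calc z ^ 6 + z ^ 15 = z ^ 5 * (z + z ^ 10) := by ring
    _ ≤ z ^ 5 * 1 := by gcongr; linarith
    _ = z ^ 5 := mul_one _

theorem measureReal_fiberCount_unbalanced_le (n : ℕ) (p : ι)
    (h : Fintype.card ι * Real.exp (-(n / Fintype.card ι / 8)) ≤ 1) :
    (Measure.pi fun _ : Fin n => (PMF.uniformOfFintype ι).toMeasure).real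
        {f | ¬ (n / Fintype.card ι / 2 ≤ (fiberCount f p : ℝ) ∧
          (fiberCount f p : ℝ) ≤ 2 * (n / Fintype.card ι))}
      ≤ Real.exp (-(n / Fintype.card ι / 8)) := by
  have hm : (0 : ℝ) ≤ n / Fintype.card ι := by positivity
  rcases le_or_gt (Fintype.card ι) 2 with hN | hN
  · refine (measureReal_mono ?_).trans
      ((measureReal_fiberCount_le_half n p).trans (Real.exp_le_exp.mpr (by linarith)))
    intro f hf
    simp only [Set.mem_ofPred_eq, fiberCount_le_of_card_le_two n hN f p, and_true, not_le] at hf ⊢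
    exact hf.le
  · have h3 : (3 : ℝ) ≤ Fintype.card ι := by exact_mod_cast hN
    have hx : Real.exp (-((n : ℝ) / Fintype.card ι / 8)) ≤ 1 / 3 := by
      nlinarith [Real.exp_pos (-((n : ℝ) / Fintype.card ι / 8))]
    refine le_trans ?_ (exp_tails_le hx)
    refine le_trans ?_ (add_le_add (measureReal_fiberCount_le_half n p)
      (measureReal_two_mul_le_fiberCount n p))
    refine (measureReal_mono ?_).trans (measureReal_union_le _ _)
    intro f hf
    simp only [Set.mem_ofPred_eq, not_and_or, not_le, Set.mem_union] at hf ⊢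
    exact hf.imp le_of_lt le_of_lt

/-- With high probability, every fiber of a uniformly random function has size within a factor
two of its mean. -/
theorem one_sub_le_measureReal_balanced (n : ℕ) :
    1 - Fintype.card ι * Real.exp (-(n / Fintype.card ι / 8)) ≤
      (Measure.pi fun _ : Fin n => (PMF.uniformOfFintype ι).toMeasure).real
        {f | ∀ p : ι, n / Fintype.card ι / 2 ≤ (fiberCount f p : ℝ) ∧
          (fiberCount f p : ℝ) ≤ 2 * (n / Fintype.card ι)} := by
  rcases le_or_gt ((Fintype.card ι : ℝ) * Real.exp (-(n / Fintype.card ι / 8))) 1 with h | h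
  · set ν := Measure.pi fun _ : Fin n => (PMF.uniformOfFintype ι).toMeasure
    set G := {f : Fin n → ι | ∀ p : ι, n / Fintype.card ι / 2 ≤ (fiberCount f p : ℝ) ∧
          (fiberCount f p : ℝ) ≤ 2 * (n / Fintype.card ι)} with hG
    have hc : ν.real Gᶜ ≤ Fintype.card ι * Real.exp (-(n / Fintype.card ι / 8)) := by
      have : Gᶜ = ⋃ p : ι, {f : Fin n → ι | ¬ (n / Fintype.card ι / 2 ≤ (fiberCount f p : ℝ) ∧
          (fiberCount f p : ℝ) ≤ 2 * (n / Fintype.card ι))} := by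
        ext f
        simp only [hG, Set.mem_compl_iff, Set.mem_ofPred_eq, not_forall, Set.mem_iUnion]
      rw [this]
      refine (measureReal_iUnion_fintype_le _).trans ?_
      refine (Finset.sum_le_sum fun p _ => measureReal_fiberCount_unbalanced_le n p h).trans ?_
      simp
    rw [probReal_compl_eq_one_sub (Set.toFinite G).measurableSet] at hc
    linarith
  · exact le_trans (by linarith) measureReal_nonneg

end Concentration

section FiberSum

variable {ι κ : Type*} [Fintype ι] [Fintype κ] [DecidableEq ι]

theorem sum_eq_sum_fiber (f : κ → ι) (g : ι → ℝ) (u : κ → ℝ) :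
    ∑ j, g (f j) * u j = ∑ q, g q * ∑ j with f j = q, u j := by
  rw [← Finset.sum_fiberwise Finset.univ f]
  refine Finset.sum_congr rfl fun q _ => ?_
  rw [Finset.mul_sum]
  refine Finset.sum_congr rfl fun j hj => ?_
  rw [(Finset.mem_filter.mp hj).2]

end FiberSum

/-- The neural tangent kernel is positive semidefinite as soon as the derivative of the activation
is bounded. -/
theorem sum_mul_ntkEntry_nonneg {d : ℕ} {ι : Type*} [Fintype ι] {φ : ℝ → ℝ} {B : ℝ}
    (hφ' : ∀ z, |deriv φ z| ≤ B) (c : ι → Fin d → ℝ) (w : ι → ℝ) :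
    0 ≤ ∑ p, w p * ∑ q, ntkEntry φ (c p) (c q) * w q := by
  have : IsProbabilityMeasure (stdGaussianPi d) := by unfold stdGaussianPi; infer_instance
  have hmeas : ∀ p, Measurable fun g : Fin d → ℝ => deriv φ (∑ m, c p m * g m) := fun p =>
    (measurable_deriv φ).comp (by fun_prop)
  have hint : ∀ p q, Integrable (fun g : Fin d → ℝ =>
      deriv φ (∑ m, c p m * g m) * deriv φ (∑ m, c q m * g m)) (stdGaussianPi d) := by
    intro p q
    refine .of_bound ((hmeas p).mul (hmeas q)).aestronglyMeasurable (B * B) (.of_forall fun g => ?_)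
    rw [Real.norm_eq_abs, abs_mul]
    exact mul_le_mul (hφ' _) (hφ' _) (abs_nonneg _) ((abs_nonneg _).trans (hφ' 0))
  have key : ∑ p, w p * ∑ q, ntkEntry φ (c p) (c q) * w q
      = ∫ g, ∑ m, (∑ p, w p * c p m * deriv φ (∑ m, c p m * g m)) ^ 2 ∂stdGaussianPi d := by
    have expand : ∀ g : Fin d → ℝ,
        ∑ m, (∑ p, w p * c p m * deriv φ (∑ m, c p m * g m)) ^ 2
        = ∑ p, ∑ q, (w p * w q * ∑ m, c p m * c q m) *
          (deriv φ (∑ m, c p m * g m) * deriv φ (∑ m, c q m * g m)) := by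
      intro g
      simp only [sq, Finset.mul_sum, Finset.sum_mul]
      rw [Finset.sum_comm]
      refine Finset.sum_congr rfl fun p _ => ?_
      rw [Finset.sum_comm]
      refine Finset.sum_congr rfl fun q _ => Finset.sum_congr rfl fun m _ => ?_
      ring
    simp only [expand]
    rw [integral_finsetSum _ fun p _ => integrable_finsetSum _ fun q _ => (hint p q).const_mul _]
    refine Finset.sum_congr rfl fun p _ => ?_
    rw [integral_finsetSum _ fun q _ => (hint p q).const_mul _, Finset.mul_sum]
    refine Finset.sum_congr rfl fun q _ => ?_
    rw [integral_const_mul, ntkEntry]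
    ring
  rw [key]
  exact integral_nonneg fun g => Finset.sum_nonneg fun m _ => sq_nonneg _

theorem norm_le_of_abs_le {ι : Type*} [Fintype ι] {r : ℝ} (hr : 0 ≤ r)
    {u v : EuclideanSpace ℝ ι} (h : ∀ i, |u i| ≤ r * |v i|) : ‖u‖ ≤ r * ‖v‖ := by
  rw [← abs_of_nonneg hr, ← Real.norm_eq_abs, ← norm_smul, EuclideanSpace.norm_eq,
    EuclideanSpace.norm_eq]
  refine Real.sqrt_le_sqrt (Finset.sum_le_sum fun i _ => ?_)
  rw [PiLp.smul_apply, norm_smul, Real.norm_eq_abs r, abs_of_nonneg hr]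
  exact pow_le_pow_left₀ (norm_nonneg _) (h i) 2

section SingularValues

variable {ι : Type*} [Fintype ι] [DecidableEq ι]

theorem minSing_mul_norm_le (A : Matrix ι ι ℝ) (v : EuclideanSpace ℝ ι) :
    minSing A * ‖v‖ ≤ ‖Matrix.toEuclideanLin A v‖ := by
  rcases eq_or_ne v 0 with rfl | hv
  · simp
  have hpos : 0 < ‖v‖ := norm_pos_iff.mpr hv
  have hu : ‖(‖v‖⁻¹ : ℝ) • v‖ = 1 := by
    rw [norm_smul, norm_inv, norm_norm, inv_mul_cancel₀ hpos.ne']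
  have h : minSing A ≤ ‖Matrix.toEuclideanLin A ((‖v‖⁻¹ : ℝ) • v)‖ :=
    ciInf_le (f := fun u : {u : EuclideanSpace ℝ ι // ‖u‖ = 1} => ‖Matrix.toEuclideanLin A u.1‖)
      ⟨0, by rintro _ ⟨u, rfl⟩; exact norm_nonneg _⟩ ⟨_, hu⟩
  rwa [map_smul, norm_smul, norm_inv, norm_norm, ← div_eq_inv_mul, le_div_iff₀ hpos] at h

theorem norm_toEuclideanLin_le (A : Matrix ι ι ℝ) (v : EuclideanSpace ℝ ι) :
    ‖Matrix.toEuclideanLin A v‖ ≤ specNorm A * ‖v‖ :=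
  (Matrix.toEuclideanLin A).toContinuousLinearMap.le_opNorm v

/-- Eigenvalues of a positive diagonal matrix times a positive semidefinite matrix. -/
theorem eigenvalue_diagonal_mul_bounds {A : Matrix ι ι ℝ}
    (hA : ∀ w : ι → ℝ, 0 ≤ ∑ p, w p * ∑ q, A p q * w q) {D : ι → ℝ} {a b t : ℝ} (ha : 0 < a)
    (hD : ∀ p, a ≤ D p ∧ D p ≤ b) {w : ι → ℝ} (hw : w ≠ 0)
    (ht : ∀ p, D p * ∑ q, A p q * w q = t * w p) :
    a * minSing A ≤ t ∧ t ≤ b * specNorm A := by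
  have hD0 : ∀ p, 0 < D p := fun p => ha.trans_le (hD p).1
  obtain ⟨p₀, hp₀⟩ := Function.ne_iff.mp hw
  have hb : 0 ≤ b := ha.le.trans ((hD p₀).1.trans (hD p₀).2)
  set v : EuclideanSpace ℝ ι := WithLp.toLp 2 w with hv
  have hAv : ∀ p, Matrix.toEuclideanLin A v p = ∑ q, A p q * w q := fun p => rfl
  have hv0 : 0 < ‖v‖ := by
    rw [norm_pos_iff]
    exact fun h => hw (by simpa [hv] using h)
  have hAw : ∀ p, ∑ q, A p q * w q = t * (w p / D p) := by
    intro p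
    have := ht p
    have := (hD0 p).ne'
    field_simp
    linarith
  have ht0 : 0 ≤ t := by
    have h := hA w
    simp only [hAw] at h
    have e : ∑ p, w p * (t * (w p / D p)) = t * ∑ p, w p ^ 2 / D p := by
      rw [Finset.mul_sum]
      exact Finset.sum_congr rfl fun p _ => by ring
    rw [e] at h
    refine nonneg_of_mul_nonneg_left h (Finset.sum_pos' (fun p _ => ?_) ⟨p₀, Finset.mem_univ _, ?_⟩)
    · exact div_nonneg (sq_nonneg _) (hD0 p).le
    · exact div_pos (pow_pos (abs_pos.mpr hp₀) 2 |>.trans_eq (sq_abs _)) (hD0 p₀)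
  constructor
  · have h1 : ‖Matrix.toEuclideanLin A v‖ ≤ t / a * ‖v‖ := by
      refine norm_le_of_abs_le (by positivity) fun p => ?_
      rw [hAv, hAw, abs_mul, abs_of_nonneg ht0, abs_div, abs_of_pos (hD0 p)]
      change t * (|w p| / D p) ≤ t / a * |w p|
      rw [div_mul_eq_mul_div, ← mul_div_assoc]
      exact div_le_div_of_nonneg_left (by positivity) ha (hD p).1
    have h2 := le_of_mul_le_mul_right ((minSing_mul_norm_le A v).trans h1) hv0
    rw [le_div_iff₀ ha] at h2
    linarith
  · have h1 : ‖t • v‖ ≤ b * ‖Matrix.toEuclideanLin A v‖ := by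
      refine norm_le_of_abs_le hb fun p => ?_
      change |t * w p| ≤ _
      rw [← ht, hAv, abs_mul, abs_of_pos (hD0 p)]
      exact mul_le_mul_of_nonneg_right (hD p).2 (abs_nonneg _)
    rw [norm_smul, Real.norm_eq_abs, abs_of_nonneg ht0] at h1
    refine le_of_mul_le_mul_right (h1.trans ?_) hv0
    rw [mul_assoc]
    exact mul_le_mul_of_nonneg_left (norm_toEuclideanLin_le A v) hb

end SingularValues

/-- Pull `K` vectors indexed by `ι` back along `f : Fin n → ι` and concatenate them. -/
def replicate {n : ℕ} {ι : Type*} (K : ℕ) (f : Fin n → ι) :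
    (Fin K × ι → ℝ) →ₗ[ℝ] EuclideanSpace ℝ (Fin K × Fin n) where
  toFun c := WithLp.toLp 2 fun a => c (a.1, f a.2)
  map_add' _ _ := rfl
  map_smul' _ _ := rfl

theorem replicate_injective {n K : ℕ} {ι : Type*} {f : Fin n → ι} (hf : Function.Surjective f) :
    Function.Injective (replicate K f) := by
  intro c c' h
  funext ⟨a, p⟩
  obtain ⟨i, rfl⟩ := hf p
  exact congrArg (fun v : EuclideanSpace ℝ (Fin K × Fin n) => v (a, i)) h

section Replication

variable {d n K : ℕ} {ι : Type*} [Fintype ι] [DecidableEq ι]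

theorem mNTK_apply_replicated {φ : ℝ → ℝ} {c : ι → Fin d → ℝ} {S : Matrix ι ι ℝ}
    (hS : ∀ p q, S p q = ntkEntry φ (c p) (c q)) {f : Fin n → ι} {X : Matrix (Fin n) (Fin d) ℝ}
    (hX : ∀ i j, X i j = c (f i) j) (v : EuclideanSpace ℝ (Fin K × Fin n))
    (a : Fin K × Fin n) :
    Matrix.toEuclideanLin (mNTK K φ X) v a
      = ∑ q, S (f a.2) q * ∑ j with f j = q, v (a.1, j) := by
  have h : Matrix.toEuclideanLin (mNTK K φ X) v a
      = ∑ b : Fin K × Fin n, mNTK K φ X a b * v b := rfl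
  rw [h, Fintype.sum_prod_type, Finset.sum_eq_single a.1 (fun k _ hk => ?_) (by simp),
    ← sum_eq_sum_fiber f (fun q => S (f a.2) q) (fun j => v (a.1, j))]
  · refine Finset.sum_congr rfl fun j _ => ?_
    simp only [mNTK, Matrix.of_apply, if_true, hX, hS]
  · refine Finset.sum_eq_zero fun j _ => ?_
    simp [mNTK, hk.symm]

theorem range_mNTK_replicated {φ : ℝ → ℝ} {c : ι → Fin d → ℝ} {S : Matrix ι ι ℝ}
    (hS : ∀ p q, S p q = ntkEntry φ (c p) (c q)) (hdet : S.det ≠ 0) {f : Fin n → ι}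
    (hf : ∀ p, fiberCount f p ≠ 0) {X : Matrix (Fin n) (Fin d) ℝ}
    (hX : ∀ i j, X i j = c (f i) j) :
    LinearMap.range (Matrix.toEuclideanLin (mNTK K φ X)) = LinearMap.range (replicate K f) := by
  apply le_antisymm
  · rintro _ ⟨v, rfl⟩
    refine ⟨fun b => ∑ q, S b.2 q * ∑ j with f j = q, v (b.1, j), ?_⟩
    ext a
    exact (mNTK_apply_replicated hS hX v a).symm
  · rintro _ ⟨g, rfl⟩
    refine ⟨WithLp.toLp 2 fun a =>
      (S⁻¹ *ᵥ fun p => g (a.1, p)) (f a.2) / fiberCount f (f a.2), ?_⟩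
    ext a
    rw [mNTK_apply_replicated hS hX]
    have hsum : ∀ q, ∑ j with f j = q,
        (S⁻¹ *ᵥ fun p => g (a.1, p)) (f j) / (fiberCount f (f j) : ℝ)
        = (S⁻¹ *ᵥ fun p => g (a.1, p)) q := by
      intro q
      have hq : (fiberCount f q : ℝ) ≠ 0 := by exact_mod_cast hf q
      rw [Finset.sum_congr rfl fun j hj => by rw [(Finset.mem_filter.mp hj).2],
        Finset.sum_const, nsmul_eq_mul]
      exact mul_div_cancel₀ _ hq
    simp only [hsum]
    change (S *ᵥ (S⁻¹ *ᵥ fun p => g (a.1, p))) (f a.2) = g (a.1, f a.2)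
    rw [Matrix.mulVec_mulVec, Matrix.mul_nonsing_inv _ (isUnit_iff_ne_zero.mpr hdet),
      Matrix.one_mulVec]

theorem eigenvector_mNTK_replicated {φ : ℝ → ℝ} {c : ι → Fin d → ℝ} {S : Matrix ι ι ℝ}
    (hS : ∀ p q, S p q = ntkEntry φ (c p) (c q)) {f : Fin n → ι} {X : Matrix (Fin n) (Fin d) ℝ}
    (hX : ∀ i j, X i j = c (f i) j) {t : ℝ}
    (ht : Module.End.HasEigenvalue (Matrix.toEuclideanLin (mNTK K φ X)) t) (ht0 : t ≠ 0) :
    ∃ w : ι → ℝ, w ≠ 0 ∧ ∀ p, (fiberCount f p : ℝ) * ∑ q, S p q * w q = t * w p := by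
  obtain ⟨v, hv⟩ := ht.exists_hasEigenvector
  have hva : ∀ a, ∑ q, S (f a.2) q * ∑ j with f j = q, v (a.1, j) = t * v a := by
    intro a
    rw [← mNTK_apply_replicated hS hX, hv.apply_eq_smul]
    rfl
  obtain ⟨a, ha⟩ : ∃ a, v a ≠ 0 := by
    by_contra! h
    exact hv.2 (by ext a; exact h a)
  refine ⟨fun q => ∑ j with f j = q, v (a.1, j), fun h => ?_, fun p => ?_⟩
  · have h0 : ∀ q, ∑ j with f j = q, v (a.1, j) = 0 := fun q => congrFun h q
    have := hva a
    simp only [h0, mul_zero, Finset.sum_const_zero] at this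
    exact mul_ne_zero ht0 ha this.symm
  · change _ = t * ∑ j with f j = p, v (a.1, j)
    rw [fiberCount, ← nsmul_eq_mul, ← Finset.sum_const, Finset.mul_sum]
    refine Finset.sum_congr rfl fun i hi => ?_
    rw [← hva (a.1, i), (Finset.mem_filter.mp hi).2]

end Replication

/-- **The Jacobian of the noiseless Gaussian mixture model is low-rank** (Theorem A.1).
With `n` data points whose cluster memberships are i.i.d. uniform over the `KC`
class/cluster pairs, inputs equal to the (unit-norm) cluster centers (`σ = 0`), labels
one-hot in the class, `Σ(X)` the multiclass NTK with output scaling `ν = 1/√k`, `I` its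
range, and `Σ̃(M)` the (full-rank) NTK of the cluster-center matrix `M`: with
probability at least `1 − KC·exp(−n/(8KC))`, (i) `I` has dimension `K²C`, (ii) the
concatenated label vector lies in `I`, and (iii) every nonzero eigenvalue `t` of `Σ(X)`
satisfies `(n/(2KC))·s_min(Σ̃(M)) ≤ t ≤ (2n/(KC))·‖Σ̃(M)‖`. -/
theorem gmm_noiseless_jacobian_low_rank
    {d n K C : ℕ} [NeZero K] [NeZero C]
    (φ : ℝ → ℝ) (B : ℝ)
    (hφ : Differentiable ℝ φ) (hφ' : ∀ z, |deriv φ z| ≤ B)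
    -- unit-norm cluster centers
    (centers : Fin K × Fin C → Fin d → ℝ)
    (hcenters : ∀ p, euclNorm (centers p) = 1)
    -- the NTK of the cluster-center matrix, assumed full rank
    (SigM : Matrix (Fin K × Fin C) (Fin K × Fin C) ℝ)
    (hSigM : ∀ p q, SigM p q = ntkEntry φ (centers p) (centers q))
    (hfull : SigM.det ≠ 0)
    -- i.i.d. uniform cluster assignments
    {Ω : Type*} [MeasurableSpace Ω] (μ : Measure Ω) [IsProbabilityMeasure μ]
    (assign : Ω → Fin n → Fin K × Fin C)
    (hassign : Measure.map assign μ
      = Measure.pi fun _ : Fin n => (PMF.uniformOfFintype (Fin K × Fin C)).toMeasure)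
    -- the resulting data matrix and one-hot label vector
    (Xm : Ω → Matrix (Fin n) (Fin d) ℝ)
    (hXm : ∀ ω i j, Xm ω i j = centers (assign ω i) j)
    (yv : Ω → EuclideanSpace ℝ (Fin K × Fin n))
    (hyv : ∀ ω a, yv ω a = if a.1 = (assign ω a.2).1 then (1 : ℝ) else 0) :
    ENNReal.ofReal (1 - (K : ℝ) * C * Real.exp (-(n : ℝ) / (8 * K * C)))
      ≤ μ {ω |
          Module.finrank ℝ
              (LinearMap.range (Matrix.toEuclideanLin (mNTK K φ (Xm ω)))) = K ^ 2 * C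
          ∧ yv ω ∈ LinearMap.range (Matrix.toEuclideanLin (mNTK K φ (Xm ω)))
          ∧ ∀ t : ℝ,
              Module.End.HasEigenvalue (Matrix.toEuclideanLin (mNTK K φ (Xm ω))) t →
              t ≠ 0 →
              (n : ℝ) / (2 * K * C) * minSing SigM ≤ t
              ∧ t ≤ 2 * n / (K * C) * specNorm SigM} := by
  have hK : (0 : ℝ) < K := by exact_mod_cast Nat.pos_of_ne_zero (NeZero.ne K)
  have hC : (0 : ℝ) < C := by exact_mod_cast Nat.pos_of_ne_zero (NeZero.ne C)
  have hcard : (Fintype.card (Fin K × Fin C) : ℝ) = K * C := by simp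
  have hmeas : AEMeasurable assign μ := by
    refine AEMeasurable.of_map_ne_zero ?_
    rw [hassign]
    exact IsProbabilityMeasure.ne_zero _
  set m : ℝ := n / Fintype.card (Fin K × Fin C) with hm
  set G : Set (Fin n → Fin K × Fin C) :=
    {f | ∀ p, m / 2 ≤ (fiberCount f p : ℝ) ∧ (fiberCount f p : ℝ) ≤ 2 * m} with hG
  have hexp : (K : ℝ) * C * Real.exp (-(n : ℝ) / (8 * K * C))
      = Fintype.card (Fin K × Fin C) * Real.exp (-(m / 8)) := by
    rw [hm, hcard]
    congr 2
    field_simp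
  rcases Nat.eq_zero_or_pos n with rfl | hn
  · have h1 : (1 : ℝ) ≤ K * C := by
      rw [← hcard]
      exact_mod_cast Fintype.card_pos
    rw [ENNReal.ofReal_of_nonpos (by simpa using h1)]
    exact zero_le
  have hn' : (0 : ℝ) < n := by exact_mod_cast hn
  have hm0 : 0 < m := by rw [hm, hcard]; positivity
  have hprob : ENNReal.ofReal (1 - (K : ℝ) * C * Real.exp (-(n : ℝ) / (8 * K * C)))
      ≤ μ (assign ⁻¹' G) := by
    rw [← Measure.map_apply_of_aemeasurable hmeas (Set.toFinite G).measurableSet, hassign, hexp]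
    exact (ENNReal.ofReal_le_ofReal (one_sub_le_measureReal_balanced n)).trans
      ENNReal.ofReal_toReal_le
  refine hprob.trans (measure_mono fun ω hω => ?_)
  have hcount : ∀ p, m / 2 ≤ (fiberCount (assign ω) p : ℝ) ∧
      (fiberCount (assign ω) p : ℝ) ≤ 2 * m := hω
  have hne : ∀ p, fiberCount (assign ω) p ≠ 0 := by
    intro p h
    have := (hcount p).1
    rw [h, Nat.cast_zero] at this
    linarith
  have hsurj : Function.Surjective (assign ω) := by
    intro p
    obtain ⟨i, hi⟩ := Finset.card_ne_zero.mp (hne p)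
    exact ⟨i, (Finset.mem_filter.mp hi).2⟩
  have hrange := range_mNTK_replicated (K := K) hSigM hfull hne (hXm ω)
  refine ⟨?_, ?_, fun t ht ht0 => ?_⟩
  · rw [hrange, LinearMap.finrank_range_of_inj (replicate_injective hsurj)]
    simp
    ring
  · rw [hrange]
    refine ⟨fun b => if b.1 = b.2.1 then 1 else 0, ?_⟩
    ext a
    exact (hyv ω a).symm
  · obtain ⟨w, hw, hwt⟩ := eigenvector_mNTK_replicated hSigM (hXm ω) ht ht0
    have hpsd : ∀ u : Fin K × Fin C → ℝ, 0 ≤ ∑ p, u p * ∑ q, SigM p q * u q := by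
      simp only [hSigM]
      exact sum_mul_ntkEntry_nonneg hφ' centers
    have h := eigenvalue_diagonal_mul_bounds hpsd (half_pos hm0) hcount hw hwt
    have e1 : (n : ℝ) / (2 * K * C) = m / 2 := by
      rw [hm, hcard]
      field_simp
    have e2 : 2 * (n : ℝ) / (K * C) = 2 * m := by
      rw [hm, hcard, mul_div_assoc]
    rw [e1, e2]
    exact h
end

section
/- Asymmetric PSD increase (Lemma 5.3 of the paper). Let A, B ∈ ℝ^{n×p} be matrices with spectral norms ‖A‖ ≤ β, ‖B‖ ≤ β, and ‖B − A‖ ≤ ε. Then for every vector r ∈ ℝ^n and every step size η ≤ 1/β², one has ‖(I − ηABᵀ)r‖ ≤ (1 + ηε²)‖r‖. -/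
open Matrix MeasureTheory ProbabilityTheory
open scoped BigOperators ENNReal

open ContinuousLinearMap in
/-- A gradient-type step along `S ∘ T†` increases the norm by a factor of at most
`1 + η * ‖T - S‖ ^ 2`. -/
theorem norm_sub_smul_comp_adjoint_le {E F : Type*}
    [NormedAddCommGroup E] [InnerProductSpace ℝ E] [CompleteSpace E]
    [NormedAddCommGroup F] [InnerProductSpace ℝ F] [CompleteSpace F]
    (S T : F →L[ℝ] E) {β ε η : ℝ} (hS : ‖S‖ ≤ β) (hTS : ‖T - S‖ ≤ ε)
    (hη0 : 0 ≤ η) (hη : η * β ^ 2 ≤ 1) (r : E) :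
    ‖r - η • S (adjoint T r)‖ ≤ (1 + η * ε ^ 2) * ‖r‖ := by
  have hdiff : ‖adjoint T r - adjoint S r‖ ≤ ε * ‖r‖ := by
    rw [← _root_.sub_apply, ← map_sub]
    refine le_of_opNorm_le _ ?_ r
    rwa [LinearIsometryEquiv.norm_map]
  have hdiff_sq : ‖adjoint T r - adjoint S r‖ ^ 2 ≤ (ε * ‖r‖) ^ 2 := by gcongr
  have hstep : ‖S (adjoint T r)‖ ^ 2 ≤ (β * ‖adjoint T r‖) ^ 2 := by
    gcongr
    exact le_of_opNorm_le _ hS _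
  have hinner : inner ℝ r (S (adjoint T r)) = inner ℝ (adjoint T r) (adjoint S r) := by
    rw [← adjoint_inner_left, real_inner_comm]
  have hexpand := norm_sub_sq_real r (η • S (adjoint T r))
  rw [inner_smul_right, hinner, norm_smul, Real.norm_of_nonneg hη0] at hexpand
  have hexpand_diff := norm_sub_sq_real (adjoint T r) (adjoint S r)
  have hquad : (η * ‖S (adjoint T r)‖) ^ 2 ≤ η * ‖adjoint T r‖ ^ 2 :=
    calc (η * ‖S (adjoint T r)‖) ^ 2 = η ^ 2 * ‖S (adjoint T r)‖ ^ 2 := by ring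
      _ ≤ η ^ 2 * (β * ‖adjoint T r‖) ^ 2 := by gcongr
      _ = (η * β ^ 2) * (η * ‖adjoint T r‖ ^ 2) := by ring
      _ ≤ 1 * (η * ‖adjoint T r‖ ^ 2) := by gcongr
      _ = η * ‖adjoint T r‖ ^ 2 := one_mul _
  have hsq : ‖r - η • S (adjoint T r)‖ ^ 2 ≤ (1 + η * ε ^ 2) * ‖r‖ ^ 2 := by
    nlinarith [mul_le_mul_of_nonneg_left hdiff_sq hη0,
      mul_nonneg hη0 (sq_nonneg ‖adjoint S r‖)]
  have hfactor : 1 ≤ 1 + η * ε ^ 2 := le_add_of_nonneg_right (by positivity)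
  refine (sq_le_sq₀ (norm_nonneg _) (by positivity)).1 ?_
  calc ‖r - η • S (adjoint T r)‖ ^ 2 ≤ (1 + η * ε ^ 2) * ‖r‖ ^ 2 := hsq
    _ ≤ (1 + η * ε ^ 2) ^ 2 * ‖r‖ ^ 2 := by
      gcongr
      exact le_self_pow₀ hfactor two_ne_zero
    _ = ((1 + η * ε ^ 2) * ‖r‖) ^ 2 := by ring

/-- **Asymmetric PSD increase** (Lemma 5.3).  If `A, B ∈ ℝ^{n×p}` have spectral norms
bounded by `β` and `‖B − A‖ ≤ ε`, then for every `r ∈ ℝ^n` and step size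
`0 ≤ η ≤ 1/β²` one has `‖(I − ηABᵀ)r‖ ≤ (1 + ηε²)‖r‖`. -/
theorem asymmetric_psd_increase {n p : ℕ}
    (A B : Matrix (Fin n) (Fin p) ℝ) (β ε η : ℝ)
    (hA : specNorm A ≤ β) (hB : specNorm B ≤ β)
    (hBA : specNorm (B - A) ≤ ε)
    (hη0 : 0 ≤ η) (hη : η ≤ 1 / β ^ 2)
    (r : EuclideanSpace ℝ (Fin n)) :
    ‖r - η • Matrix.toEuclideanLin (A * Bᵀ) r‖ ≤ (1 + η * ε ^ 2) * ‖r‖ := by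
  have hη' : η * β ^ 2 ≤ 1 :=
    (mul_le_mul_of_nonneg_right hη (sq_nonneg β)).trans <| by
      rw [div_mul_eq_mul_div, one_mul]
      exact div_self_le_one _
  have hmul : Matrix.toEuclideanLin (A * Bᵀ) r = (Matrix.toEuclideanLin A).toContinuousLinearMap
      (ContinuousLinearMap.adjoint (Matrix.toEuclideanLin B).toContinuousLinearMap r) := by
    rw [← LinearMap.adjoint_toContinuousLinearMap, ← Matrix.toEuclideanLin_conjTranspose_eq_adjoint,
      Matrix.conjTranspose_eq_transpose_of_trivial]
    simp [Matrix.toLpLin_apply, Matrix.mulVec_mulVec]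
  rw [hmul]
  refine norm_sub_smul_comp_adjoint_le _ _ hA ?_ hη0 hη' r
  rwa [specNorm, map_sub, map_sub] at hBA
end

section
/- Square-root perturbation of PSD matrices (Lemma 5.4 of the paper). Let A and B be n×n positive semidefinite matrices with ‖A − B‖ ≤ α² in spectral norm for a scalar α ≥ 0. Then for any X ∈ ℝ^{n×p} with p ≥ n satisfying A = XXᵀ, there exists a matrix Y ∈ ℝ^{n×p} satisfying B = YYᵀ and ‖Y − X‖ ≤ 2α. -/
open Matrix MeasureTheory ProbabilityTheory
open scoped BigOperators ENNReal

/-- Two linear maps with pointwise equal norms differ by a linear isometry of the codomain. -/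
theorem exists_linearIsometry_comp_eq {E F : Type*} [AddCommGroup E] [Module ℝ E]
    [NormedAddCommGroup F] [InnerProductSpace ℝ F] [FiniteDimensional ℝ F]
    (f g : E →ₗ[ℝ] F) (h : ∀ v, ‖f v‖ = ‖g v‖) :
    ∃ L : F →ₗᵢ[ℝ] F, ∀ v, L (f v) = g v := by
  obtain ⟨s, hs⟩ := f.rangeRestrict.exists_rightInverse_of_surjective f.range_rangeRestrict
  have hs' (w : LinearMap.range f) : f (s w) = w :=
    congrArg Subtype.val (LinearMap.congr_fun hs w)
  let L₀ : LinearMap.range f →ₗᵢ[ℝ] F :=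
    { g ∘ₗ s with
      norm_map' := fun w ↦ by
        change ‖g (s w)‖ = ‖w‖
        rw [← h, hs']
        rfl }
  refine ⟨L₀.extend, fun v ↦ ?_⟩
  have hL : L₀.extend (f v) = g (s (f.rangeRestrict v)) :=
    L₀.extend_apply (f.rangeRestrict v)
  have hzero : ‖g (s (f.rangeRestrict v) - v)‖ = 0 := by
    rw [← h, map_sub, hs']
    simp
  rw [hL]
  exact sub_eq_zero.mp (by rwa [norm_eq_zero, map_sub] at hzero)

section L2Operator

open scoped Matrix.Norms.L2Operator

theorem specNorm_eq_norm {m n : Type*} [Fintype m] [Fintype n] [DecidableEq n]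
    (A : Matrix m n ℝ) : specNorm A = ‖A‖ := rfl

theorem norm_mul_eq_of_mul_transpose_eq_one {l m n : Type*} [Fintype l] [Fintype m] [Fintype n]
    [DecidableEq l] [DecidableEq m] [DecidableEq n] (M : Matrix l m ℝ) {K : Matrix m n ℝ}
    (hK : K * Kᵀ = 1) : ‖M * K‖ = ‖M‖ := by
  refine (mul_self_inj (norm_nonneg _) (norm_nonneg _)).mp ?_
  rw [← l2_opNorm_conjTranspose (M * K), ← l2_opNorm_conjTranspose M,
    ← l2_opNorm_conjTranspose_mul_self, ← l2_opNorm_conjTranspose_mul_self]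
  simp only [conjTranspose_eq_transpose_of_trivial, transpose_transpose, transpose_mul]
  rw [Matrix.mul_assoc, ← Matrix.mul_assoc K, hK, Matrix.one_mul]

theorem abs_dotProduct_mulVec_le {n : Type*} [Fintype n] [DecidableEq n]
    (M : Matrix n n ℝ) (v : n → ℝ) : |v ⬝ᵥ M *ᵥ v| ≤ ‖M‖ * (v ⬝ᵥ v) := by
  set x : EuclideanSpace ℝ n := WithLp.toLp 2 v
  have hx : ‖x‖ * ‖x‖ = v ⬝ᵥ v := by
    rw [← real_inner_self_eq_norm_mul_norm, EuclideanSpace.inner_eq_star_dotProduct]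
    simp [x]
  rw [← inner_toEuclideanCLM M x x, ← hx]
  calc |inner ℝ x (toEuclideanCLM (𝕜 := ℝ) M x)|
      ≤ ‖x‖ * ‖toEuclideanCLM (𝕜 := ℝ) M x‖ := abs_real_inner_le_norm _ _
    _ ≤ ‖x‖ * (‖M‖ * ‖x‖) := by
      gcongr
      exact (toEuclideanCLM (𝕜 := ℝ) M).le_opNorm x
    _ = ‖M‖ * (‖x‖ * ‖x‖) := by ring

/-- The square root is `1/2`-Hölder in spectral norm on positive semidefinite matrices. -/
theorem norm_sub_le_of_norm_mul_self_sub_le {n : Type*} [Fintype n] [DecidableEq n]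
    {S T : Matrix n n ℝ} (hS : S.PosSemidef) (hT : T.PosSemidef) {α : ℝ} (hα : 0 ≤ α)
    (h : ‖S * S - T * T‖ ≤ α ^ 2) : ‖T - S‖ ≤ α := by
  rw [norm_sub_rev]
  have hD : (S - T).IsHermitian := hS.1.sub hT.1
  rw [← cfc_id ℝ (S - T) hD.isSelfAdjoint]
  refine norm_cfc_le hα fun μ hμ ↦ ?_
  rw [← spectrum_toLpLin 2, ← Module.End.hasEigenvalue_iff_mem_spectrum] at hμ
  obtain ⟨x, hx⟩ := hμ.exists_hasEigenvector
  set v : n → ℝ := x.ofLp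
  have hv : (S - T) *ᵥ v = μ • v := congrArg WithLp.ofLp hx.apply_eq_smul
  have hv₀ : v ≠ 0 := fun h₀ ↦ hx.2 (by ext i; exact congrFun h₀ i)
  have hpos : 0 < v ⬝ᵥ v := by simpa using dotProduct_star_self_pos_iff.mpr hv₀
  have hSv : 0 ≤ v ⬝ᵥ S *ᵥ v := by simpa using hS.dotProduct_mulVec_nonneg v
  have hTv : 0 ≤ v ⬝ᵥ T *ᵥ v := by simpa using hT.dotProduct_mulVec_nonneg v
  have hdiff : v ⬝ᵥ S *ᵥ v - v ⬝ᵥ T *ᵥ v = μ * (v ⬝ᵥ v) := by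
    rw [← dotProduct_sub, ← sub_mulVec, hv, dotProduct_smul, smul_eq_mul]
  have hleft : v ᵥ* (S - T) = μ • v := by
    rw [← mulVec_transpose, ← conjTranspose_eq_transpose_of_trivial, hD.eq, hv]
  have hquad : v ⬝ᵥ (S * S - T * T) *ᵥ v = μ * (v ⬝ᵥ S *ᵥ v + v ⬝ᵥ T *ᵥ v) := by
    have hfactor : S * S - T * T = S * (S - T) + (S - T) * T := by noncomm_ring
    rw [hfactor, add_mulVec, dotProduct_add, ← mulVec_mulVec, ← mulVec_mulVec, hv,
      dotProduct_mulVec v (S - T), hleft, mulVec_smul, dotProduct_smul, smul_dotProduct]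
    simp only [smul_eq_mul]
    ring
  have hbound := (abs_dotProduct_mulVec_le (S * S - T * T) v).trans
    (mul_le_mul_of_nonneg_right h hpos.le)
  rw [hquad, abs_mul, abs_of_nonneg (add_nonneg hSv hTv)] at hbound
  have hsum : |μ| * (v ⬝ᵥ v) ≤ v ⬝ᵥ S *ᵥ v + v ⬝ᵥ T *ᵥ v := by
    nth_rw 1 [← abs_of_pos hpos]
    rw [← abs_mul, ← hdiff, abs_le]
    constructor <;> linarith
  have hmul : |μ| ^ 2 * (v ⬝ᵥ v) ≤ α ^ 2 * (v ⬝ᵥ v) := by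
    nlinarith [mul_le_mul_of_nonneg_left hsum (abs_nonneg μ)]
  exact (sq_le_sq₀ (abs_nonneg μ) hα).mp (le_of_mul_le_mul_right hmul hpos)

/-- Two factors of the same Gram matrix differ by an orthogonal matrix. -/
theorem exists_mul_transpose_eq_one_of_mul_transpose_eq {m n : Type*} [Fintype m] [Fintype n]
    [DecidableEq m] [DecidableEq n] (P R : Matrix m n ℝ) (h : P * Pᵀ = R * Rᵀ) :
    ∃ Q : Matrix n n ℝ, Q * Qᵀ = 1 ∧ R = P * Q := by
  have norm_sq (N : Matrix m n ℝ) (x : EuclideanSpace ℝ m) :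
      ‖toEuclideanLin Nᵀ x‖ ^ 2 = x.ofLp ⬝ᵥ (N * Nᵀ) *ᵥ x.ofLp := by
    rw [← real_inner_self_eq_norm_sq, EuclideanSpace.inner_eq_star_dotProduct, ← mulVec_mulVec,
      dotProduct_mulVec, ← mulVec_transpose]
    simp [toLpLin_apply]
  obtain ⟨L, hL⟩ := exists_linearIsometry_comp_eq (toEuclideanLin Pᵀ) (toEuclideanLin Rᵀ)
    fun x ↦ by
      rw [← sq_eq_sq₀ (norm_nonneg _) (norm_nonneg _), norm_sq, norm_sq, h]
  let Φ := toEuclideanCLM (n := n) (𝕜 := ℝ)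
  let W := Φ.symm L.toContinuousLinearMap
  have hΦW : Φ W = L.toContinuousLinearMap := Φ.apply_symm_apply _
  refine ⟨Wᵀ, ?_, ?_⟩
  · refine EquivLike.injective Φ ?_
    rw [transpose_transpose, ← conjTranspose_eq_transpose_of_trivial, ← star_eq_conjTranspose,
      map_mul, map_star, map_one, hΦW]
    exact (ContinuousLinearMap.norm_map_iff_adjoint_comp_self _).mp L.norm_map
  · rw [← transpose_inj, transpose_mul, transpose_transpose]
    apply toEuclideanLin.injective
    ext1 x
    rw [← hL]
    have hW (y : EuclideanSpace ℝ n) : L y = Φ W y := by rw [hΦW]; rfl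
    rw [hW]
    simp [Φ, toLpLin_apply, toEuclideanCLM_toLp]

end L2Operator

open scoped MatrixOrder Matrix.Norms.L2Operator in
theorem Matrix.PosSemidef.exists_posSemidef_mul_self {n : Type*} [Fintype n] [DecidableEq n]
    {A : Matrix n n ℝ} (hA : A.PosSemidef) : ∃ S : Matrix n n ℝ, S.PosSemidef ∧ S * S = A :=
  ⟨CFC.sqrt A, (CFC.sqrt_nonneg A).posSemidef, CFC.sqrt_mul_sqrt_self A hA.nonneg⟩

/-- **Square-root perturbation of PSD matrices** (Lemma 5.4).  If `A` and `B` are `n×n`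
positive semidefinite real matrices with `‖A − B‖ ≤ α²` in spectral norm, then for any
`X ∈ ℝ^{n×p}` with `p ≥ n` and `A = XXᵀ` there exists `Y ∈ ℝ^{n×p}` with `B = YYᵀ`
and `‖Y − X‖ ≤ 2α`. -/
theorem psd_sqrt_perturbation {n p : ℕ} (hnp : n ≤ p)
    (A B : Matrix (Fin n) (Fin n) ℝ)
    (hA : A.PosSemidef) (hB : B.PosSemidef)
    (α : ℝ) (hα : 0 ≤ α)
    (hAB : specNorm (A - B) ≤ α ^ 2)
    (X : Matrix (Fin n) (Fin p) ℝ) (hX : A = X * Xᵀ) :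
    ∃ Y : Matrix (Fin n) (Fin p) ℝ, B = Y * Yᵀ ∧ specNorm (Y - X) ≤ 2 * α := by
  obtain ⟨S, hS, rfl⟩ := hA.exists_posSemidef_mul_self
  obtain ⟨T, hT, rfl⟩ := hB.exists_posSemidef_mul_self
  have hSt : Sᵀ = S := by rw [← conjTranspose_eq_transpose_of_trivial, hS.1.eq]
  have hTt : Tᵀ = T := by rw [← conjTranspose_eq_transpose_of_trivial, hT.1.eq]
  let J : Matrix (Fin n) (Fin p) ℝ := (1 : Matrix (Fin p) (Fin p) ℝ).submatrix (Fin.castLE hnp) id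
  have hJ : J * Jᵀ = 1 := by
    rw [transpose_submatrix, ← submatrix_mul _ _ _ _ _ Function.bijective_id]
    simp [submatrix_one _ (Fin.castLE_injective hnp)]
  have gram {K : Matrix (Fin n) (Fin p) ℝ} (hK : K * Kᵀ = 1) (M : Matrix (Fin n) (Fin n) ℝ) :
      M * K * (M * K)ᵀ = M * Mᵀ := by
    rw [transpose_mul, Matrix.mul_assoc, ← Matrix.mul_assoc K, hK, Matrix.one_mul]
  obtain ⟨Q, hQ, rfl⟩ := exists_mul_transpose_eq_one_of_mul_transpose_eq (S * J) X
    (by rw [gram hJ, hSt, hX])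
  have hJQ : J * Q * (J * Q)ᵀ = 1 := by
    rw [transpose_mul, Matrix.mul_assoc, ← Matrix.mul_assoc Q, hQ, Matrix.one_mul, hJ]
  refine ⟨T * (J * Q), by rw [gram hJQ, hTt], ?_⟩
  rw [Matrix.mul_assoc S, ← Matrix.sub_mul, specNorm_eq_norm,
    norm_mul_eq_of_mul_transpose_eq_one _ hJQ]
  exact (norm_sub_le_of_norm_mul_self_sub_le hS hT hα hAB).trans (by linarith)
end

section
/- One-step perturbation tracking (Lemma 5.7 of the paper). Let f: ℝ^p → ℝ^{nK} be differentiable with Jacobian J(θ), let y ∈ ℝ^{nK}, θ0 ∈ ℝ^p, and let J̄ be an (ε0, β) reference Jacobian for J(θ0). Assume ‖J(θ)‖ ≤ β for all θ, and ‖J(θ) − J(θ0)‖ ≤ ε/2 for all θ with ‖θ − θ0‖ ≤ R. Consider the gradient descent iterate θ_{τ+1} = θ_τ − η J(θ_τ)ᵀ(f(θ_τ) − y) and the linearized residual recursion r̃_{τ+1} = (I − ηJ̄J̄ᵀ)r̃_τ, and suppose ‖θ_τ − θ0‖ ≤ R and ‖θ_{τ+1} − θ0‖ ≤ R. Then with η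 ≤ 1/β², the deviation e_τ = r_τ − r̃_τ between the original residual r_τ = f(θ_τ) − y and the linearized residual satisfies ‖e_{τ+1}‖ ≤ η(ε0² + εβ)‖r̃_τ‖ + (1 + ηε²)‖e_τ‖. -/
open Matrix MeasureTheory ProbabilityTheory
open scoped BigOperators ENNReal

open ContinuousLinearMap in
/-- If `A` and `B` are `ε`-close and `‖A‖ ≤ β` with `η β² ≤ 1`, then `1 - η A B†` expands norms by
a factor of at most `1 + η ε²`. -/
theorem norm_sub_smul_apply_adjoint_le {E F : Type*}
    [NormedAddCommGroup E] [InnerProductSpace ℝ E] [CompleteSpace E]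
    [NormedAddCommGroup F] [InnerProductSpace ℝ F] [CompleteSpace F]
    (A B : E →L[ℝ] F) {β ε η : ℝ} (hA : ‖A‖ ≤ β) (hAB : ‖A - B‖ ≤ ε)
    (hη0 : 0 ≤ η) (hη : η * β ^ 2 ≤ 1) (v : F) :
    ‖v - η • A (adjoint B v)‖ ≤ (1 + η * ε ^ 2) * ‖v‖ := by
  have hdiff : ‖adjoint A v - adjoint B v‖ ≤ ε * ‖v‖ := by
    rw [← _root_.sub_apply, ← map_sub]
    exact le_of_opNorm_le _ ((LinearIsometryEquiv.norm_map _ _).trans_le hAB) v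
  have happ : ‖A (adjoint B v)‖ ≤ β * ‖adjoint B v‖ := le_of_opNorm_le _ hA _
  have hexp : ‖v - η • A (adjoint B v)‖ ^ 2 =
      ‖v‖ ^ 2 - 2 * η * inner ℝ (adjoint A v) (adjoint B v) + η ^ 2 * ‖A (adjoint B v)‖ ^ 2 := by
    rw [norm_sub_sq_real, inner_smul_right, adjoint_inner_left, norm_smul, mul_pow,
      Real.norm_eq_abs, sq_abs]
    ring
  have hpol := norm_sub_sq_real (adjoint A v) (adjoint B v)
  have happ2 : ‖A (adjoint B v)‖ ^ 2 ≤ β ^ 2 * ‖adjoint B v‖ ^ 2 := by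
    rw [← mul_pow]; gcongr
  have hdiff2 : ‖adjoint A v - adjoint B v‖ ^ 2 ≤ ε ^ 2 * ‖v‖ ^ 2 := by
    rw [← mul_pow]; gcongr
  have hquad : η ^ 2 * ‖A (adjoint B v)‖ ^ 2 ≤ η * ‖adjoint B v‖ ^ 2 := by
    calc η ^ 2 * ‖A (adjoint B v)‖ ^ 2 ≤ η ^ 2 * (β ^ 2 * ‖adjoint B v‖ ^ 2) := by gcongr
      _ = (η * β ^ 2) * (η * ‖adjoint B v‖ ^ 2) := by ring
      _ ≤ 1 * (η * ‖adjoint B v‖ ^ 2) := by gcongr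
      _ = η * ‖adjoint B v‖ ^ 2 := one_mul _
  have hcross : η * (‖adjoint B v‖ ^ 2 - 2 * inner ℝ (adjoint A v) (adjoint B v)) ≤
      η * (ε ^ 2 * ‖v‖ ^ 2) := by
    gcongr
    linarith [sq_nonneg ‖adjoint A v‖]
  refine le_of_sq_le_sq ?_ (by positivity)
  have : 0 ≤ η * ε ^ 2 * ‖v‖ ^ 2 := by positivity
  nlinarith [sq_nonneg (η * ε ^ 2 * ‖v‖)]

open ContinuousLinearMap in
/-- One step of the perturbed recursion `r ↦ r - η A B† r` against the linear recursion
`s ↦ s - η M s`, where `A` and `B` are `ε / 2`-close to `L` and `M` is `δ`-close to `L L†`. -/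
theorem norm_perturbed_step_sub_linear_step_le {E F : Type*}
    [NormedAddCommGroup E] [InnerProductSpace ℝ E] [CompleteSpace E]
    [NormedAddCommGroup F] [InnerProductSpace ℝ F] [CompleteSpace F]
    (A B L : E →L[ℝ] F) (M : F →L[ℝ] F) {β ε δ η : ℝ}
    (hA : ‖A‖ ≤ β) (hL : ‖L‖ ≤ β) (hAL : ‖A - L‖ ≤ ε / 2) (hBL : ‖B - L‖ ≤ ε / 2)
    (hM : ‖L ∘L adjoint L - M‖ ≤ δ) (hη0 : 0 ≤ η) (hη : η * β ^ 2 ≤ 1) (r s : F) :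
    ‖(r - η • A (adjoint B r)) - (s - η • M s)‖ ≤
      η * (δ + ε * β) * ‖s‖ + (1 + η * ε ^ 2) * ‖r - s‖ := by
  have hβ : 0 ≤ β := (norm_nonneg _).trans hA
  have hε : 0 ≤ ε / 2 := (norm_nonneg _).trans hAL
  have hAB : ‖A - B‖ ≤ ε := by
    calc ‖A - B‖ = ‖(A - L) - (B - L)‖ := by rw [sub_sub_sub_cancel_right]
      _ ≤ ‖A - L‖ + ‖B - L‖ := norm_sub_le _ _
      _ ≤ ε := by linarith
  have hexpand := norm_sub_smul_apply_adjoint_le A B hA hAB hη0 hη (r - s)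
  have hop : ‖M s - A (adjoint B s)‖ ≤ (δ + ε * β) * ‖s‖ := by
    have hsplit : M s - A (adjoint B s) =
        -((L ∘L adjoint L - M) s) - (A - L) (adjoint L s) - A (adjoint (B - L) s) := by
      simp only [_root_.sub_apply, ContinuousLinearMap.comp_apply, map_sub]
      abel
    have h1 := le_of_opNorm_le _ hM s
    have hLs : ‖adjoint L s‖ ≤ β * ‖s‖ :=
      le_of_opNorm_le _ ((LinearIsometryEquiv.norm_map _ _).trans_le hL) s
    have hBs : ‖adjoint (B - L) s‖ ≤ ε / 2 * ‖s‖ :=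
      le_of_opNorm_le _ ((LinearIsometryEquiv.norm_map _ _).trans_le hBL) s
    have h2 : ‖(A - L) (adjoint L s)‖ ≤ ε / 2 * (β * ‖s‖) :=
      (le_of_opNorm_le _ hAL _).trans (by gcongr)
    have h3 : ‖A (adjoint (B - L) s)‖ ≤ β * (ε / 2 * ‖s‖) :=
      (le_of_opNorm_le _ hA _).trans (by gcongr)
    rw [hsplit]
    refine (norm_sub_le _ _).trans ((add_le_add_left (norm_sub_le _ _) _).trans ?_)
    rw [norm_neg]
    linarith
  have hdecomp : (r - η • A (adjoint B r)) - (s - η • M s) =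
      η • (M s - A (adjoint B s)) + ((r - s) - η • A (adjoint B (r - s))) := by
    simp only [map_sub, smul_sub]
    abel
  rw [hdecomp]
  refine (norm_add_le _ _).trans (add_le_add ?_ hexpand)
  rw [norm_smul, Real.norm_of_nonneg hη0, mul_assoc]
  gcongr

/-- The averaged derivative along a segment: it maps `b - a` to `f b - f a` and stays in every
closed ball that contains the derivative of `f` along the segment. -/
theorem exists_averaged_fderiv {E F : Type*}
    [NormedAddCommGroup E] [NormedSpace ℝ E] [FiniteDimensional ℝ E]
    [NormedAddCommGroup F] [NormedSpace ℝ F] [FiniteDimensional ℝ F]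
    {f : E → F} {f' : E → E →L[ℝ] F} (hf : ∀ x, HasFDerivAt f (f' x) x)
    {C : ℝ} (hC : ∀ x, ‖f' x‖ ≤ C) (a b : E) :
    ∃ A : E →L[ℝ] F, A (b - a) = f b - f a ∧
      ∀ (L : E →L[ℝ] F) (c : ℝ), (∀ x ∈ segment ℝ a b, ‖f' x - L‖ ≤ c) → ‖A - L‖ ≤ c := by
  have : CompleteSpace F := FiniteDimensional.complete ℝ F
  have : CompleteSpace (E →L[ℝ] F) := FiniteDimensional.complete ℝ _
  borelize E
  borelize (E →L[ℝ] F)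
  set γ : ℝ →ᵃ[ℝ] E := AffineMap.lineMap a b with hγ
  have hmeas : StronglyMeasurable fun t => f' (γ t) := by
    have hf' : f' = fderiv ℝ f := funext fun x => (hf x).fderiv.symm
    rw [hf']
    exact ((measurable_fderiv ℝ f).comp
      (AffineMap.lineMap_continuous (R := ℝ)).measurable).stronglyMeasurable
  have hint : IntervalIntegrable (fun t => f' (γ t)) volume 0 1 :=
    (intervalIntegrable_const (c := C)).mono_fun hmeas.aestronglyMeasurable
      (Filter.Eventually.of_forall fun t => (hC _).trans (le_abs_self C))
  refine ⟨∫ t in (0 : ℝ)..1, f' (γ t), ?_, fun L c hc => ?_⟩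
  · rw [ContinuousLinearMap.intervalIntegral_apply hint,
      intervalIntegral.integral_eq_sub_of_hasDerivAt (f := fun t => f (γ t))
        (fun t _ => (hf (γ t)).comp_hasDerivAt t AffineMap.hasDerivAt_lineMap)
        ⟨hint.1.apply_continuousLinearMap _, hint.2.apply_continuousLinearMap _⟩]
    simp [hγ]
  · have hsub : (∫ t in (0 : ℝ)..1, f' (γ t)) - L = ∫ t in (0 : ℝ)..1, (f' (γ t) - L) := by
      rw [intervalIntegral.integral_sub hint intervalIntegrable_const]
      simp
    rw [hsub]
    refine (intervalIntegral.norm_integral_le_of_norm_le_const (C := c) fun t ht => ?_).trans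
      (by simp)
    rw [Set.uIoc_of_le zero_le_one] at ht
    exact hc _ (by
      rw [segment_eq_image_lineMap]
      exact ⟨t, ⟨ht.1.le, ht.2⟩, rfl⟩)

/-- The continuous linear map of a transposed real matrix is the adjoint. -/
theorem adjoint_toContinuousLinearMap_toEuclideanLin {m n : Type*} [Fintype m] [Fintype n]
    [DecidableEq m] [DecidableEq n] (A : Matrix m n ℝ) :
    ContinuousLinearMap.adjoint (Matrix.toEuclideanLin A).toContinuousLinearMap =
      (Matrix.toEuclideanLin Aᵀ).toContinuousLinearMap := by
  rw [← Matrix.conjTranspose_eq_transpose_of_trivial,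
    Matrix.toEuclideanLin_conjTranspose_eq_adjoint]
  rfl

/-- **One-step perturbation tracking** (Lemma 5.7).  With `J̄` an `(ε0, β)` reference
Jacobian for `J(θ0)`, `‖J(θ)‖ ≤ β` everywhere, `‖J(θ) − J(θ0)‖ ≤ ε/2` on the ball of
radius `R` around `θ0`, gradient iterates `θ_{τ+1} = θ_τ − ηJ(θ_τ)ᵀ(f(θ_τ) − y)`,
linearized residuals `r̃_{τ+1} = (I − ηJ̄J̄ᵀ)r̃_τ`, and both `θ_τ, θ_{τ+1}` within
radius `R` of `θ0`, the deviation `e_τ = r_τ − r̃_τ` satisfies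
`‖e_{τ+1}‖ ≤ η(ε0² + εβ)‖r̃_τ‖ + (1 + ηε²)‖e_τ‖` whenever `0 < η ≤ 1/β²`. -/
theorem one_step_perturbation_tracking
    {p N : ℕ}
    (f : EuclideanSpace ℝ (Fin p) → EuclideanSpace ℝ (Fin N))
    (J : EuclideanSpace ℝ (Fin p) → Matrix (Fin N) (Fin p) ℝ)
    (hf : ∀ θ, HasFDerivAt f ((Matrix.toEuclideanLin (J θ)).toContinuousLinearMap) θ)
    (y : EuclideanSpace ℝ (Fin N))
    (θ0 : EuclideanSpace ℝ (Fin p))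
    -- `J(θ0)` padded with zero columns to size `N × max N p`
    (padJ : Matrix (Fin N) (Fin (max N p)) ℝ)
    (hpadJ : ∀ a (j : Fin (max N p)),
      padJ a j = if h : (j : ℕ) < p then J θ0 a ⟨j, h⟩ else 0)
    -- `(ε0, β)` reference Jacobian conditions
    (Jb : Matrix (Fin N) (Fin (max N p)) ℝ)
    (ε0 β : ℝ)
    (href1 : specNorm Jb ≤ β)
    (href2 : specNorm (J θ0 * (J θ0)ᵀ - Jb * Jbᵀ) ≤ ε0 ^ 2)
    (href3 : specNorm (padJ - Jb) ≤ ε0)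
    (ε R η : ℝ)
    (hbound : ∀ θ, specNorm (J θ) ≤ β)
    (hlip : ∀ θ, ‖θ - θ0‖ ≤ R → specNorm (J θ - J θ0) ≤ ε / 2)
    (hη0 : 0 < η) (hη : η ≤ 1 / β ^ 2)
    -- gradient descent iterates and linearized residuals
    (θ : ℕ → EuclideanSpace ℝ (Fin p))
    (hθ0 : θ 0 = θ0)
    (hθrec : ∀ t, θ (t + 1) = θ t
      - η • Matrix.toEuclideanLin (J (θ t))ᵀ (f (θ t) - y))
    (rt : ℕ → EuclideanSpace ℝ (Fin N))
    (hrt0 : rt 0 = f θ0 - y)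
    (hrtrec : ∀ t, rt (t + 1) = rt t - η • Matrix.toEuclideanLin (Jb * Jbᵀ) (rt t))
    (τ : ℕ)
    (hτ : ‖θ τ - θ0‖ ≤ R) (hτ1 : ‖θ (τ + 1) - θ0‖ ≤ R) :
    ‖(f (θ (τ + 1)) - y) - rt (τ + 1)‖
      ≤ η * (ε0 ^ 2 + ε * β) * ‖rt τ‖ + (1 + η * ε ^ 2) * ‖(f (θ τ) - y) - rt τ‖ := by
  have hβ0 : 0 < β ^ 2 := by
    by_contra h
    have : β ^ 2 = 0 := le_antisymm (not_lt.mp h) (sq_nonneg β)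
    simp only [this, div_zero] at hη
    exact hη0.not_ge hη
  have hη' : η * β ^ 2 ≤ 1 := (le_div_iff₀ hβ0).mp hη
  set D : EuclideanSpace ℝ (Fin p) → EuclideanSpace ℝ (Fin p) →L[ℝ] EuclideanSpace ℝ (Fin N) :=
    fun x => (Matrix.toEuclideanLin (J x)).toContinuousLinearMap with hD
  have hDlip : ∀ x, ‖x - θ0‖ ≤ R → ‖D x - D θ0‖ ≤ ε / 2 := by
    intro x hx
    simpa only [specNorm, map_sub] using hlip x hx
  obtain ⟨A, hAeq, hAball⟩ := exists_averaged_fderiv hf hbound (θ τ) (θ (τ + 1))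
  have hA : ‖A‖ ≤ β := by
    simpa using hAball 0 β fun x _ => by simpa [specNorm] using hbound x
  have hAL : ‖A - D θ0‖ ≤ ε / 2 := hAball _ _ fun x hx => hDlip x <| by
    have hmem := (convex_closedBall θ0 R).segment_subset
      (mem_closedBall_iff_norm.mpr hτ) (mem_closedBall_iff_norm.mpr hτ1) hx
    exact mem_closedBall_iff_norm.mp hmem
  have hM : ‖D θ0 ∘L ContinuousLinearMap.adjoint (D θ0) -
      (Matrix.toEuclideanLin (Jb * Jbᵀ)).toContinuousLinearMap‖ ≤ ε0 ^ 2 := by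
    convert href2 using 1
    rw [specNorm, map_sub, map_sub, hD, adjoint_toContinuousLinearMap_toEuclideanLin]
    congr 2
    ext v : 1
    simp [Matrix.toLpLin_apply, Matrix.mulVec_mulVec]
  have hstep : f (θ (τ + 1)) - y = (f (θ τ) - y) -
      η • A (ContinuousLinearMap.adjoint (D (θ τ)) (f (θ τ) - y)) := by
    have hθ : θ (τ + 1) - θ τ =
        -(η • ContinuousLinearMap.adjoint (D (θ τ)) (f (θ τ) - y)) := by
      rw [hθrec τ, hD, adjoint_toContinuousLinearMap_toEuclideanLin]
      simp
    rw [hθ, map_neg, map_smul] at hAeq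
    rw [sub_eq_add_neg _ (η • _), hAeq]
    abel
  rw [hstep, hrtrec τ]
  exact norm_perturbed_step_sub_linear_step_le A (D (θ τ)) (D θ0) _ hA (hbound θ0) hAL
    (hDlip _ hτ) hM hη0.le hη' _ _
end

section
/- Bounding the residual perturbation growth (Lemma 5.8 of Section 6.1.2 of the paper). Let Γ, α, ε, η > 0 satisfy η ≤ 1/α² and α ≥ √(2Γ)·ε, and set T = Γ/(ηα²). Let Θ, ρ₊, ρ₋ ≥ 0 and suppose nonnegative scalar sequences e_τ (with e_0 = 0) and r̃_τ satisfy, for all 0 ≤ τ ≤ T, r̃_τ ≤ (1 − ηα²)^τ ρ₊ + ρ₋ and e_τ ≤ (1 + ηε²)e_{τ−1} + ηΘ·r̃_{τ−1}. Then for all 0 ≤ τ ≤ T one has e_τ ≤ Θ·Λ, where Λ = 2(Γρ₋ + ρ₊)/α². -/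
/-- Unrolling a perturbed linear recursion whose forcing term decays geometrically to a constant. -/
theorem le_of_geometric_forcing {η a δ Θ ρp ρm : ℝ} (hη : 0 ≤ η) (hηa : η * a ≤ 1) (hδ : 0 ≤ δ)
    (hΘ : 0 ≤ Θ) (hρp : 0 ≤ ρp) (hρm : 0 ≤ ρm) (ha : 0 ≤ a) {e r : ℕ → ℝ} (he0 : e 0 = 0) (n : ℕ)
    (hr : ∀ k < n, r k ≤ (1 - η * a) ^ k * ρp + ρm)
    (he : ∀ k < n, e (k + 1) ≤ (1 + δ) * e k + η * Θ * r k) :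
    a * e n ≤ Θ * (1 + δ) ^ n * (ρp * (1 - (1 - η * a) ^ n) + n * (η * a) * ρm) := by
  induction n with
  | zero => simp [he0]
  | succ n ih =>
    have ih' := ih (fun k hk => hr k (by lia)) (fun k hk => he k (by lia))
    have hforce : 0 ≤ (1 - η * a) ^ n * ρp + ρm := by
      have := pow_nonneg (sub_nonneg.2 hηa) n
      positivity
    have hpow : 1 ≤ (1 + δ) ^ (n + 1) := one_le_pow₀ (by linarith)
    calc a * e (n + 1) ≤ a * ((1 + δ) * e n + η * Θ * r n) := by
          gcongr
          exact he n (by lia)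
      _ ≤ a * ((1 + δ) * e n + η * Θ * ((1 - η * a) ^ n * ρp + ρm)) := by
          gcongr
          exact hr n (by lia)
      _ = (1 + δ) * (a * e n) + a * η * Θ * ((1 - η * a) ^ n * ρp + ρm) * 1 := by ring
      _ ≤ (1 + δ) * (Θ * (1 + δ) ^ n * (ρp * (1 - (1 - η * a) ^ n) + n * (η * a) * ρm)) +
            a * η * Θ * ((1 - η * a) ^ n * ρp + ρm) * (1 + δ) ^ (n + 1) := by
          gcongr
      _ = _ := by
          push_cast
          ring

theorem one_add_pow_le_two {δ : ℝ} (hδ : 0 ≤ δ) {n : ℕ} (h : n * δ ≤ 1 / 2) :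
    (1 + δ) ^ n ≤ 2 := by
  calc (1 + δ) ^ n ≤ Real.exp δ ^ n := by
        gcongr
        linarith [Real.add_one_le_exp δ]
    _ = Real.exp (n * δ) := (Real.exp_nat_mul δ n).symm
    _ ≤ Real.exp (1 / 2) := Real.exp_le_exp.2 h
    _ ≤ 1 / (1 - 1 / 2) := Real.exp_bound_div_one_sub_of_interval (by norm_num) (by norm_num)
    _ = 2 := by norm_num

/-- **Bounding the residual perturbation growth** (Lemma 5.8 of Section 6.1.2).
Let `Γ, α, ε, η > 0` satisfy `η ≤ 1/α²` and `α ≥ √(2Γ)·ε`, and set `T = Γ/(ηα²)`.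
Let `Θ, ρ₊, ρ₋ ≥ 0` and suppose the nonnegative scalar sequences `e` (with `e 0 = 0`) and
`r̃` satisfy, for all `0 ≤ τ ≤ T`, `r̃ τ ≤ (1 − ηα²)^τ ρ₊ + ρ₋` and
`e τ ≤ (1 + ηε²) e (τ−1) + ηΘ r̃ (τ−1)`.  Then for all `0 ≤ τ ≤ T` one has
`e τ ≤ Θ Λ` with `Λ = 2(Γρ₋ + ρ₊)/α²`. -/
theorem residual_perturbation_growth
    (Γ α ε η : ℝ) (hΓ : 0 < Γ) (hα : 0 < α) (hε : 0 < ε) (hη : 0 < η)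
    (hηα : η ≤ 1 / α ^ 2) (hαε : Real.sqrt (2 * Γ) * ε ≤ α)
    (Θ ρp ρm : ℝ) (hΘ : 0 ≤ Θ) (hρp : 0 ≤ ρp) (hρm : 0 ≤ ρm)
    (e r : ℕ → ℝ)
    (he0 : e 0 = 0)
    (hepos : ∀ τ, 0 ≤ e τ) (hrpos : ∀ τ, 0 ≤ r τ)
    (hr : ∀ τ : ℕ, (τ : ℝ) ≤ Γ / (η * α ^ 2) →
      r τ ≤ (1 - η * α ^ 2) ^ τ * ρp + ρm)
    (he : ∀ τ : ℕ, ((τ : ℝ) + 1) ≤ Γ / (η * α ^ 2) →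
      e (τ + 1) ≤ (1 + η * ε ^ 2) * e τ + η * Θ * r τ) :
    ∀ τ : ℕ, (τ : ℝ) ≤ Γ / (η * α ^ 2) →
      e τ ≤ Θ * (2 * (Γ * ρm + ρp) / α ^ 2) := by
  intro n hn
  have hα2 : 0 < α ^ 2 := by positivity
  have hηα2 : 0 < η * α ^ 2 := by positivity
  have hstep : η * α ^ 2 ≤ 1 := (le_div_iff₀ hα2).1 hηα
  have hnΓ : n * (η * α ^ 2) ≤ Γ := (le_div_iff₀ hηα2).1 hn
  have hΓε : 2 * Γ * ε ^ 2 ≤ α ^ 2 := by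
    have := pow_le_pow_left₀ (by positivity) hαε 2
    rwa [mul_pow, Real.sq_sqrt (by positivity)] at this
  have hhalf : n * (η * ε ^ 2) ≤ 1 / 2 := by
    have : n * η * (2 * Γ * ε ^ 2) ≤ n * η * α ^ 2 := by gcongr
    refine le_of_mul_le_mul_left ?_ hΓ
    linarith
  have hunroll := le_of_geometric_forcing hη.le hstep (δ := η * ε ^ 2) (by positivity) hΘ hρp hρm
    hα2.le he0 n
    (fun k hk => hr k (le_trans (by exact_mod_cast hk.le) hn))
    (fun k hk => he k (le_trans (by exact_mod_cast hk) hn))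
  have hgrowth := one_add_pow_le_two (by positivity) hhalf
  have hdecay : 0 ≤ (1 - η * α ^ 2) ^ n := pow_nonneg (sub_nonneg.2 hstep) n
  rw [← mul_div_assoc, le_div_iff₀ hα2, mul_comm (e n)]
  calc α ^ 2 * e n ≤ _ := hunroll
    _ ≤ Θ * (1 + η * ε ^ 2) ^ n * (ρp * 1 + Γ * ρm) := by
        gcongr
        linarith
    _ ≤ Θ * 2 * (ρp * 1 + Γ * ρm) := by gcongr
    _ = Θ * (2 * (Γ * ρm + ρp)) := by ring
end

section
/- Properties of the single-output neural net Jacobian (Lemma 6.1 of the paper). Consider a one-hidden-layer network with one output, x ↦ vᵀφ(Wx), with v ∈ ℝ^k and W ∈ ℝ^{k×d}, data aggregated as rows of X ∈ ℝ^{n×d}, and Jacobian J(W) ∈ ℝ^{n×kd} of the prediction vector with respect to vect(W), given explicitly by J(W) = [J(w_1), …, J(w_k)] with J(w_s) = v_s·diag(φ'(Xw_s))·X. If |φ'(z)| ≤ B for all z, then: (a) ‖J(W)‖ ≤ B√k·‖v‖_∞·‖X‖; and (b) for any unit vector u ∈ ℝ^n, every row of mat(J(W)ᵀu) ∈ ℝ^{k×d}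 has Euclidean norm at most B‖v‖_∞‖X‖. If furthermore φ is twice differentiable with |φ''(z)| ≤ B for all z and all data points have unit Euclidean norm, then for all W̃, W ∈ ℝ^{k×d}, ‖J(W̃) − J(W)‖ ≤ B‖v‖_∞‖X‖·‖W̃ − W‖_F. -/
open Matrix MeasureTheory ProbabilityTheory
open scoped BigOperators ENNReal

/-- Largest absolute entry of a finitely indexed family of reals. -/
noncomputable def maxAbs {ι : Type*} [Fintype ι] (f : ι → ℝ) : ℝ :=
  ⨆ i, |f i|

section helpers

variable {m n p q : Type*} [Fintype m] [Fintype n] [Fintype p] [Fintype q]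

theorem specNorm_nonneg [DecidableEq n] (A : Matrix m n ℝ) : 0 ≤ specNorm A :=
  norm_nonneg _

theorem norm_toEuclideanLin_sq [DecidableEq n] (A : Matrix m n ℝ) (x : EuclideanSpace ℝ n) :
    ‖Matrix.toEuclideanLin A x‖ ^ 2 = ∑ i, (∑ j, A i j * x j) ^ 2 := by
  rw [EuclideanSpace.real_norm_sq_eq]
  simp [Matrix.toLpLin_apply, Matrix.mulVec, dotProduct]

theorem sum_sq_mulVec_le [DecidableEq n] (A : Matrix m n ℝ) (x : n → ℝ) :
    ∑ i, (∑ j, A i j * x j) ^ 2 ≤ specNorm A ^ 2 * ∑ j, x j ^ 2 := by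
  have h := (Matrix.toEuclideanLin A).toContinuousLinearMap.le_opNorm (WithLp.toLp 2 x)
  have h2 := pow_le_pow_left₀ (norm_nonneg _) h 2
  rw [mul_pow, EuclideanSpace.real_norm_sq_eq (WithLp.toLp 2 x),
    LinearMap.coe_toContinuousLinearMap', norm_toEuclideanLin_sq] at h2
  exact h2

theorem specNorm_le_of_sum_sq_le [DecidableEq n] (A : Matrix m n ℝ) {C : ℝ} (hC : 0 ≤ C)
    (h : ∀ x : n → ℝ, ∑ i, (∑ j, A i j * x j) ^ 2 ≤ C ^ 2 * ∑ j, x j ^ 2) :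
    specNorm A ≤ C := by
  refine ContinuousLinearMap.opNorm_le_bound _ hC fun x => ?_
  refine abs_le_of_sq_le_sq' ?_ (by positivity) |>.2
  rw [LinearMap.coe_toContinuousLinearMap', norm_toEuclideanLin_sq, mul_pow,
    EuclideanSpace.real_norm_sq_eq]
  exact h x

theorem sum_sq_vecMul_le [DecidableEq n] (A : Matrix m n ℝ) (w : m → ℝ) :
    ∑ j, (∑ i, A i j * w i) ^ 2 ≤ specNorm A ^ 2 * ∑ i, w i ^ 2 := by
  set y : n → ℝ := fun j => ∑ i, A i j * w i with hy
  have hdual : ∑ j, y j ^ 2 = ∑ i, w i * ∑ j, A i j * y j := by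
    simp_rw [Finset.mul_sum]
    rw [Finset.sum_comm]
    refine Finset.sum_congr rfl fun j _ => ?_
    rw [sq]
    nth_rewrite 1 [hy]
    rw [Finset.sum_mul]
    exact Finset.sum_congr rfl fun i _ => by ring
  have hcs := Finset.sum_mul_sq_le_sq_mul_sq Finset.univ w (fun i => ∑ j, A i j * y j)
  rw [← hdual] at hcs
  have hA := sum_sq_mulVec_le A y
  have hw : 0 ≤ ∑ i, w i ^ 2 := Finset.sum_nonneg fun _ _ => sq_nonneg _
  change ∑ j, y j ^ 2 ≤ _
  have hS : 0 ≤ ∑ j, y j ^ 2 := Finset.sum_nonneg fun _ _ => sq_nonneg _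
  rcases hS.eq_or_lt with h0 | hpos
  · rw [← h0]
    positivity
  · have := hcs.trans (mul_le_mul_of_nonneg_left hA hw)
    nlinarith

/-- Row-wise Khatri-Rao products: weighting the blocks of `[X, …, X]` by coefficients whose rows
have Euclidean norm at most `C` multiplies the spectral norm by at most `C`. -/
theorem specNorm_rowwise_kronecker_le [DecidableEq p] [DecidableEq q]
    (A : Matrix m (p × q) ℝ) (X : Matrix m q ℝ) (c : m → p → ℝ) {C : ℝ} (hC : 0 ≤ C)
    (hA : ∀ i s j, A i (s, j) = c i s * X i j) (hc : ∀ i, ∑ s, c i s ^ 2 ≤ C ^ 2) :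
    specNorm A ≤ C * specNorm X := by
  refine specNorm_le_of_sum_sq_le A (mul_nonneg hC (specNorm_nonneg X)) fun x => ?_
  calc ∑ i, (∑ j, A i j * x j) ^ 2
      = ∑ i, (∑ s, c i s * ∑ j, X i j * x (s, j)) ^ 2 := by
        simp_rw [Fintype.sum_prod_type, hA, Finset.mul_sum, mul_assoc]
    _ ≤ ∑ i, C ^ 2 * ∑ s, (∑ j, X i j * x (s, j)) ^ 2 := by
        refine Finset.sum_le_sum fun i _ => ?_
        refine (Finset.sum_mul_sq_le_sq_mul_sq _ _ _).trans ?_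
        exact mul_le_mul_of_nonneg_right (hc i) (Finset.sum_nonneg fun _ _ => sq_nonneg _)
    _ = C ^ 2 * ∑ s, ∑ i, (∑ j, X i j * x (s, j)) ^ 2 := by
        rw [← Finset.mul_sum, Finset.sum_comm]
    _ ≤ C ^ 2 * ∑ s, specNorm X ^ 2 * ∑ j, x (s, j) ^ 2 := by
        gcongr with s
        exact sum_sq_mulVec_le X fun j => x (s, j)
    _ = (C * specNorm X) ^ 2 * ∑ j, x j ^ 2 := by
        rw [← Finset.mul_sum, Fintype.sum_prod_type]
        ring

theorem abs_le_maxAbs (f : n → ℝ) (i : n) : |f i| ≤ maxAbs f :=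
  le_ciSup (f := fun i => |f i|) (Set.finite_range _).bddAbove i

theorem maxAbs_nonneg (f : n → ℝ) : 0 ≤ maxAbs f :=
  Real.iSup_nonneg fun _ => abs_nonneg _

theorem sq_mul_le_of_abs_le {a b A B : ℝ} (ha : |a| ≤ A) (hb : |b| ≤ B) :
    (a * b) ^ 2 ≤ (B * A) ^ 2 := by
  refine sq_le_sq' ?_ ?_ <;>
    nlinarith [abs_le.1 (abs_mul a b ▸ mul_le_mul ha hb (abs_nonneg b) ((abs_nonneg a).trans ha))]

end helpers

/-- **Properties of the single-output neural net Jacobian** (Lemma 6.1).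
For the one-hidden-layer network `x ↦ vᵀφ(Wx)` with Jacobian
`J(W) = [J(w_1), …, J(w_k)]`, `J(w_s) = v_s diag(φ'(Xw_s)) X`, and `|φ'| ≤ B`:
(a) `‖J(W)‖ ≤ B√k ‖v‖_∞ ‖X‖`; (b) for any unit vector `u`, every row of
`mat(J(W)ᵀu)` has Euclidean norm at most `B‖v‖_∞‖X‖`; and if moreover `φ` is twice
differentiable with `|φ''| ≤ B` and the data points have unit norm, then
(c) `‖J(W̃) − J(W)‖ ≤ B‖v‖_∞‖X‖ ‖W̃ − W‖_F`. -/
theorem single_output_jacobian_properties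
    {n k d : ℕ}
    (φ : ℝ → ℝ) (B : ℝ)
    (hφ : Differentiable ℝ φ) (hφ' : ∀ z, |deriv φ z| ≤ B)
    (X : Matrix (Fin n) (Fin d) ℝ)
    (v : Fin k → ℝ)
    (J : Matrix (Fin k) (Fin d) ℝ → Matrix (Fin n) (Fin k × Fin d) ℝ)
    (hJ : ∀ W i s j, J W i (s, j) = v s * deriv φ (∑ j', W s j' * X i j') * X i j) :
    (∀ W, specNorm (J W) ≤ B * Real.sqrt k * maxAbs v * specNorm X)
    ∧ (∀ W, ∀ u : EuclideanSpace ℝ (Fin n), ‖u‖ = 1 →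
        ∀ s, euclNorm (fun j => ∑ i, J W i (s, j) * u i) ≤ B * maxAbs v * specNorm X)
    ∧ (Differentiable ℝ (deriv φ) → (∀ z, |deriv (deriv φ) z| ≤ B) →
        (∀ i, euclNorm (fun j => X i j) = 1) →
        ∀ Wt W : Matrix (Fin k) (Fin d) ℝ,
          specNorm (J Wt - J W) ≤ B * maxAbs v * specNorm X * frobNorm (Wt - W)) := by
  have hB : 0 ≤ B := (abs_nonneg _).trans (hφ' 0)
  have hv := maxAbs_nonneg v
  refine ⟨fun W => ?_, fun W u hu s => ?_, fun hφ2 hφ'' hX Wt W => ?_⟩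
  · refine specNorm_rowwise_kronecker_le (J W) X
      (fun i s => v s * deriv φ (∑ j', W s j' * X i j')) (by positivity) (hJ W) fun i => ?_
    refine (Finset.sum_le_card_nsmul _ _ ((B * maxAbs v) ^ 2) fun s _ =>
      sq_mul_le_of_abs_le (abs_le_maxAbs v s) (hφ' _)).trans_eq ?_
    simp only [Finset.card_univ, Fintype.card_fin, nsmul_eq_mul, mul_pow,
      Real.sq_sqrt (Nat.cast_nonneg k)]
    ring
  · have husq : ∑ i, u i ^ 2 = 1 := by
      rw [← EuclideanSpace.real_norm_sq_eq, hu, one_pow]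
    set c : Fin n → ℝ := fun i => v s * deriv φ (∑ j', W s j' * X i j') with hc
    refine Real.sqrt_le_iff.2 ⟨mul_nonneg (mul_nonneg hB hv) (specNorm_nonneg X), ?_⟩
    calc ∑ j, (∑ i, J W i (s, j) * u i) ^ 2
        = ∑ j, (∑ i, X i j * (c i * u i)) ^ 2 := by
          refine Finset.sum_congr rfl fun j _ => ?_
          congr 1
          refine Finset.sum_congr rfl fun i _ => ?_
          rw [hJ, hc]
          ring
      _ ≤ specNorm X ^ 2 * ∑ i, (c i * u i) ^ 2 := sum_sq_vecMul_le X _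
      _ ≤ specNorm X ^ 2 * ∑ i, (B * maxAbs v) ^ 2 * u i ^ 2 := by
          gcongr with i
          rw [mul_pow]
          gcongr ?_ * _
          exact sq_mul_le_of_abs_le (abs_le_maxAbs v s) (hφ' _)
      _ = (B * maxAbs v * specNorm X) ^ 2 := by
          rw [← Finset.mul_sum, husq]
          ring
  · have hlip : ∀ a b, |deriv φ a - deriv φ b| ≤ B * |a - b| := fun a b =>
      Convex.norm_image_sub_le_of_norm_deriv_le (fun x _ => hφ2 x) (fun x _ => hφ'' x)
        convex_univ (Set.mem_univ b) (Set.mem_univ a)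
    have hXsq : ∀ i, ∑ j, X i j ^ 2 = 1 := fun i => Real.sqrt_eq_one.1 (hX i)
    rw [mul_right_comm]
    refine specNorm_rowwise_kronecker_le (J Wt - J W) X
      (fun i s => v s * (deriv φ (∑ j', Wt s j' * X i j') - deriv φ (∑ j', W s j' * X i j')))
      (mul_nonneg (mul_nonneg hB hv) (Real.sqrt_nonneg _))
      (fun i s j => by rw [Matrix.sub_apply, hJ, hJ]; ring) fun i => ?_
    rw [mul_pow, frobNorm, Real.sq_sqrt (by positivity), Finset.mul_sum]
    refine Finset.sum_le_sum fun s _ => ?_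
    have hcs := Finset.sum_mul_sq_le_sq_mul_sq Finset.univ (fun j => (Wt - W) s j) (X i)
    rw [hXsq, mul_one] at hcs
    have hinner : ∑ j', Wt s j' * X i j' - ∑ j', W s j' * X i j'
        = ∑ j, (Wt - W) s j * X i j := by
      simp_rw [Matrix.sub_apply, sub_mul, Finset.sum_sub_distrib]
    refine (sq_mul_le_of_abs_le (abs_le_maxAbs v s) (hlip _ _)).trans ?_
    rw [hinner, mul_right_comm, mul_pow, sq_abs]
    gcongr
end
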